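/- arXiv:1804.02439 — 3 statements merged into one kernel-verified Lean document; each statement's English description precedes it below -/
import Mathlib

section
/- There exists a class X : Class such that for all u v : ZFSet, ↑(ZFSet.pair u v) ∈ Xᶜ if and only if u ∈ v. That is, there exists a class that is the dembership relation: the ordered d-pair of two seds (↑u)ᶜ and (↑v)ᶜ is a dember of X exactly when (↑u)ᶜ is a dember of (↑v)ᶜ. -/
/-- Double complementation is the identity on classes. -/
theorem Class.compl_compl_eq (A : Class) : Aᶜᶜ = A :=
  compl_compl (show Set ZFSet from A)

/-- Dual axiom of the existence of a membership relation: there exists a class whose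
dembers are exactly the ordered d-pairs `⟪(↑u)ᶜ, (↑v)ᶜ⟫` with `u ∈ v`. -/
theorem dembership_relation_exists :
    ∃ X : Class, ∀ u v : ZFSet, (↑(ZFSet.pair u v) : Class) ∈ Xᶜ ↔ u ∈ v := by
  let E : Class := fun p => ∃ a b : ZFSet, a ∈ b ∧ p = ZFSet.pair a b
  refine ⟨Eᶜ, fun u v => ?_⟩
  rw [Class.compl_compl_eq, Class.coe_mem]
  constructor
  · rintro ⟨a, b, hab, hp⟩
    obtain ⟨rfl, rfl⟩ := ZFSet.pair_injective hp
    exact hab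
  · exact fun h => ⟨u, v, h, rfl⟩
end

section
/- For every class X : Class, if there exists a class W with Wᶜ ∈ Xᶜ, then there exists a class Y with Yᶜ ∈ Xᶜ such that for every class Z, if Zᶜ ∈ Yᶜ then ¬(Zᶜ ∈ Xᶜ). That is, every class with at least one dember has a dember that is d-disjoint from it (dual Axiom of Regularity). -/
/-- Dual Axiom of Regularity (Axiom D⁺): every class with at least one dember has a
dember that is d-disjoint from it. -/
theorem dual_regularity (X : Class) :
    (∃ W : Class, Wᶜ ∈ Xᶜ) →
      ∃ Y : Class, Yᶜ ∈ Xᶜ ∧ ∀ Z : Class, Zᶜ ∈ Yᶜ → ¬ (Zᶜ ∈ Xᶜ) := by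
  intro h
  obtain ⟨Y, hY, hmin⟩ :=
    (InvImage.wf (fun W : Class ↦ Wᶜ) Class.mem_wf).has_min {W | Wᶜ ∈ Xᶜ} h
  exact ⟨Y, hY, fun Z hZY hZX ↦ hmin Z hZX hZY⟩
end

section
/- Let X : Class be a sed (i.e., ∃ s : ZFSet, ↑s = Xᶜ) whose dembers are nonempty (for every Y : Class with Yᶜ ∈ Xᶜ there exists U : Class with Uᶜ ∈ Yᶜ) and pairwise d-disjoint (for all Y Z : Class with Yᶜ ∈ Xᶜ, Zᶜ ∈ Xᶜ and Y ≠ Z, there is no U : Class with Uᶜ ∈ Yᶜ and Uᶜ ∈ Zᶜ). Then there exists a sed C : Class (i.e., ∃ c : ZFSet, ↑c = Cᶜ) such that for every Y : Class with Yᶜ ∈ Xᶜ, there exists a unique u : ZFSet with ↑u ∈ Yᶜ and ↑u ∈ Cᶜ. That is, the Axiom of D-Choice holds: every sed of pairwise d-disjoint nonempty seds admits a d-choice sed containing exactly one dember of each of its dembers. -/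
namespace Class

theorem compl_compl_eq_s18 (A : Class) : Aᶜᶜ = A :=
  compl_compl (α := Set ZFSet) A

/-- Quantifying over seds is quantifying over the sets that are their complements. -/
theorem exists_compl_mem_coe {y : ZFSet} : (∃ U : Class, Uᶜ ∈ (y : Class)) ↔ y.Nonempty := by
  constructor
  · rintro ⟨U, z, -, hz⟩
    exact ⟨z, hz⟩
  · rintro ⟨z, hz⟩
    exact ⟨(z : Class)ᶜ, z, (compl_compl_eq_s18 _).symm, hz⟩

end Class

open scoped ZFSet in
/-- A family of nonempty, pairwise disjoint sets has a transversal. -/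
theorem ZFSet.exists_transversal (s : ZFSet) (hne : ∀ y ∈ s, y.Nonempty)
    (hdisj : ∀ y ∈ s, ∀ z ∈ s, ∀ u, u ∈ y → u ∈ z → y = z) :
    ∃ c : ZFSet, ∀ y ∈ s, ∃! u, u ∈ y ∧ u ∈ c := by
  choose f hf using hne
  refine ⟨ZFSet.sep (fun u => ∃ y, ∃ hy : y ∈ s, u = f y hy) (⋃₀ s), fun y hy => ?_⟩
  refine ⟨f y hy, ⟨hf y hy, ZFSet.mem_sep.2
    ⟨ZFSet.mem_sUnion_of_mem (hf y hy) hy, y, hy, rfl⟩⟩, ?_⟩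
  rintro u ⟨hu, huc⟩
  obtain ⟨-, z, hz, rfl⟩ := ZFSet.mem_sep.1 huc
  obtain rfl := hdisj y hy z hz _ hu (hf z hz)
  rfl


/-- The Axiom of D-Choice: every sed of pairwise d-disjoint nonempty seds admits a
d-choice sed containing exactly one dember of each of its dembers. -/
theorem axiom_of_dchoice (X : Class) (hsed : ∃ s : ZFSet, ↑s = Xᶜ)
    (hne : ∀ Y : Class, Yᶜ ∈ Xᶜ → ∃ U : Class, Uᶜ ∈ Yᶜ)
    (hdisj : ∀ Y Z : Class, Yᶜ ∈ Xᶜ → Zᶜ ∈ Xᶜ → Y ≠ Z →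
      ¬ ∃ U : Class, Uᶜ ∈ Yᶜ ∧ Uᶜ ∈ Zᶜ) :
    ∃ C : Class, (∃ c : ZFSet, ↑c = Cᶜ) ∧
      ∀ Y : Class, Yᶜ ∈ Xᶜ →
        ∃! u : ZFSet, (↑u : Class) ∈ Yᶜ ∧ (↑u : Class) ∈ Cᶜ := by
  obtain ⟨s, hs⟩ := hsed
  have mem_compl_compl {y z : ZFSet} (h : z ∈ y) : (z : Class)ᶜᶜ ∈ (y : Class) := by
    rw [Class.compl_compl_eq_s18]
    exact Class.coe_mem.2 h
  rw [← hs] at hne hdisj ⊢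
  obtain ⟨c, hc⟩ := ZFSet.exists_transversal s
    (fun y hy => by
      have h := hne (y : Class)ᶜ (mem_compl_compl hy)
      rwa [Class.compl_compl_eq_s18, Class.exists_compl_mem_coe] at h)
    (fun y hy z hz u huy huz => by
      by_contra hyz
      refine hdisj (y : Class)ᶜ (z : Class)ᶜ (mem_compl_compl hy) (mem_compl_compl hz) ?_
        ⟨(u : Class)ᶜ, ?_, ?_⟩
      · intro h
        have h' := congrArg (fun A : Class => Aᶜ) h
        simp only [Class.compl_compl_eq_s18] at h'
        exact hyz (Class.ofSet.inj h')
      · rw [Class.compl_compl_eq_s18 (y : Class)]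
        exact mem_compl_compl huy
      · rw [Class.compl_compl_eq_s18 (z : Class)]
        exact mem_compl_compl huz)
  refine ⟨(c : Class)ᶜ, ⟨c, (Class.compl_compl_eq_s18 _).symm⟩, ?_⟩
  rintro Y ⟨y, hyY, hy⟩
  rw [← hyY, Class.compl_compl_eq_s18]
  simpa only [Class.coe_mem, Class.coe_apply] using hc y hy
end
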